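/- Let [C_1,…,C_r] be the W-characteristic set of ⟨P⟩ under the stated variable ordering, with C_i = [C_1,…,C_i] for 1 ≤ i ≤ r, and let k be the biggest integer such that C_k is normal. If k < r, then the triangular set C_{k+1} = [C_1,…,C_{k+1}] is not regular. -/

import Mathlib

open MvPolynomial

namespace CharSets

variable {n : ℕ} {K : Type*} [Field K]

/-- The coefficient of `x_i ^ d` in `F`, as a polynomial in the remaining variables. -/
noncomputable def coefv (i : Fin n) (d : ℕ) (F : MvPolynomial (Fin n) K) :
    MvPolynomial (Fin n) K :=
  ∑ m ∈ F.support.filter (fun m => m i = d), monomial (Finsupp.erase i m) (F.coeff m)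

/-- The leading coefficient of `F` with respect to the variable `x_i`. -/
noncomputable def lcv (i : Fin n) (F : MvPolynomial (Fin n) K) : MvPolynomial (Fin n) K :=
  coefv i (F.degreeOf i) F

/-- Auxiliary pseudo-division: computes (pseudo-quotient, pseudo-remainder) pairs,
with the first argument as fuel; the total power of the leading coefficient used is
exactly the fuel, so that starting with fuel `max(l - m + 1, 0)` yields the pair
`(Q, R)` of the unique representation `lc(F,x_i)^q • G = Q*F + R` with
`q = max(l - m + 1, 0)` and `deg(R, x_i) < deg(F, x_i)`. -/
noncomputable def pdivAux (i : Fin n) (F : MvPolynomial (Fin n) K) :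
    ℕ → MvPolynomial (Fin n) K × MvPolynomial (Fin n) K →
      MvPolynomial (Fin n) K × MvPolynomial (Fin n) K
  | 0, QR => QR
  | q + 1, QR =>
    if (QR.2).degreeOf i < F.degreeOf i then
      (lcv i F ^ (q + 1) * QR.1, lcv i F ^ (q + 1) * QR.2)
    else
      pdivAux i F q
        (lcv i F * QR.1 +
            coefv i ((QR.2).degreeOf i) QR.2 * X i ^ ((QR.2).degreeOf i - F.degreeOf i),
          lcv i F * QR.2 -
            coefv i ((QR.2).degreeOf i) QR.2 * X i ^ ((QR.2).degreeOf i - F.degreeOf i) * F)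

/-- The pseudo-remainder `prem(G, F, x_i)`. -/
noncomputable def prem (G F : MvPolynomial (Fin n) K) (i : Fin n) : MvPolynomial (Fin n) K :=
  (pdivAux i F (G.degreeOf i + 1 - F.degreeOf i) (0, G)).2

/-- The pseudo-quotient `pquo(G, F, x_i)`. -/
noncomputable def pquo (G F : MvPolynomial (Fin n) K) (i : Fin n) : MvPolynomial (Fin n) K :=
  (pdivAux i F (G.degreeOf i + 1 - F.degreeOf i) (0, G)).1

/-- The class of `P`: the largest index (1-based) of a variable actually occurring in `P`;
the class of a constant is `0`. -/
noncomputable def cls (P : MvPolynomial (Fin n) K) : ℕ :=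
  P.vars.sup fun i => (i : ℕ) + 1

/-- The degree of `G` in the leading variable of `P` (`0` if `P` is constant). -/
noncomputable def degLv (G P : MvPolynomial (Fin n) K) : ℕ :=
  if h : P.vars.Nonempty then G.degreeOf (P.vars.max' h) else 0

/-- `G` is R-reduced with respect to `P`, i.e. `deg(G, lv(P)) < deg(P, lv(P))`. -/
def RReduced (G P : MvPolynomial (Fin n) K) : Prop :=
  degLv G P < degLv P P

/-- The initial of `P`: its leading coefficient w.r.t. its leading variable. -/
noncomputable def ini (P : MvPolynomial (Fin n) K) : MvPolynomial (Fin n) K :=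
  if h : P.vars.Nonempty then lcv (P.vars.max' h) P else P

/-- Pseudo-remainder of `G` w.r.t. `F` in the leading variable of `F`
(in case `F` is constant, `m = 0` and the pseudo-remainder is `0`). -/
noncomputable def premLv (G F : MvPolynomial (Fin n) K) : MvPolynomial (Fin n) K :=
  if h : F.vars.Nonempty then prem G F (F.vars.max' h) else 0

/-- Pseudo-quotient of `G` w.r.t. `F` in the leading variable of `F`. -/
noncomputable def pquoLv (G F : MvPolynomial (Fin n) K) : MvPolynomial (Fin n) K :=
  if h : F.vars.Nonempty then pquo G F (F.vars.max' h) else 0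

/-- Iterated pseudo-remainder with respect to a triangular set `[T_1, …, T_r]`:
`prem(P, T) = prem(⋯prem(P, T_r, lv(T_r)), …, T_1, lv(T_1))`. -/
noncomputable def premTS (P : MvPolynomial (Fin n) K) (L : List (MvPolynomial (Fin n) K)) :
    MvPolynomial (Fin n) K :=
  L.foldr (fun T acc => premLv acc T) P

/-- The Sylvester matrix of `F` and `G` with respect to the variable `x_i`. -/
noncomputable def sylvester (i : Fin n) (F G : MvPolynomial (Fin n) K) :
    Matrix (Fin (G.degreeOf i + F.degreeOf i)) (Fin (G.degreeOf i + F.degreeOf i))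
      (MvPolynomial (Fin n) K) :=
  Matrix.of fun r c =>
    if (r : ℕ) < G.degreeOf i then
      if (r : ℕ) ≤ (c : ℕ) ∧ (c : ℕ) ≤ (r : ℕ) + F.degreeOf i then
        coefv i (F.degreeOf i + (r : ℕ) - (c : ℕ)) F
      else 0
    else
      if (r : ℕ) - G.degreeOf i ≤ (c : ℕ) ∧ (c : ℕ) ≤ (r : ℕ) then
        coefv i (G.degreeOf i + ((r : ℕ) - G.degreeOf i) - (c : ℕ)) G
      else 0

/-- The resultant `res(F, G, x_i)` of `F` and `G` w.r.t. `x_i`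
(the determinant of the Sylvester matrix). -/
noncomputable def resv (F G : MvPolynomial (Fin n) K) (i : Fin n) : MvPolynomial (Fin n) K :=
  (sylvester i F G).det

/-- Resultant of `F` and `G` w.r.t. the leading variable of `G`. -/
noncomputable def resLv (F G : MvPolynomial (Fin n) K) : MvPolynomial (Fin n) K :=
  if h : G.vars.Nonempty then resv F G (G.vars.max' h) else F

/-- Iterated resultant with respect to a triangular set:
`res(F, T) = res(⋯res(F, T_r, lv(T_r)), …, T_1, lv(T_1))`. -/
noncomputable def resTS (F : MvPolynomial (Fin n) K) (L : List (MvPolynomial (Fin n) K)) :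
    MvPolynomial (Fin n) K :=
  L.foldr (fun T acc => resLv acc T) F

/-- A triangular set: a nonempty ordered set of nonconstant polynomials with
strictly increasing classes. -/
def TriangularSet (L : List (MvPolynomial (Fin n) K)) : Prop :=
  L ≠ [] ∧ (∀ T ∈ L, 0 < cls T) ∧ L.Chain' fun A B => cls A < cls B

/-- An ascending set: either a single nonzero constant, or a triangular set in which
every later element is R-reduced with respect to every earlier one. -/
def AscendingSet (L : List (MvPolynomial (Fin n) K)) : Prop :=
  (∃ a : K, a ≠ 0 ∧ L = [MvPolynomial.C a]) ∨
    (TriangularSet L ∧ L.Pairwise fun A B => RReduced B A)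

/-- `F` has lower rank than `G`. -/
def rkLT (F G : MvPolynomial (Fin n) K) : Prop :=
  cls F < cls G ∨ (cls F = cls G ∧ 0 < cls F ∧ degLv F F < degLv G G)

/-- `F` and `G` have the same rank: neither has lower rank than the other. -/
def rkEQ (F G : MvPolynomial (Fin n) K) : Prop :=
  ¬ rkLT F G ∧ ¬ rkLT G F

/-- `B` has lower rank than `A` (as ascending sets). -/
def ascLT (B A : List (MvPolynomial (Fin n) K)) : Prop :=
  (∃ j, j < min A.length B.length ∧
      (∀ i, i < j → rkEQ (A.getD i 0) (B.getD i 0)) ∧ rkLT (B.getD j 0) (A.getD j 0)) ∨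
    (A.length < B.length ∧ ∀ i, i < A.length → rkEQ (A.getD i 0) (B.getD i 0))

/-- A Ritt characteristic set of the ideal `I`: an ascending set contained in `I`
of minimal rank among all ascending sets contained in `I`. -/
def RittCharSet (I : Ideal (MvPolynomial (Fin n) K)) (A : List (MvPolynomial (Fin n) K)) :
    Prop :=
  AscendingSet A ∧ (∀ a ∈ A, a ∈ I) ∧
    ∀ B : List (MvPolynomial (Fin n) K), AscendingSet B → (∀ b ∈ B, b ∈ I) → ¬ ascLT B A

/-- The saturated ideal of a triangular set, as a set of polynomials. -/
def satTS (L : List (MvPolynomial (Fin n) K)) : Set (MvPolynomial (Fin n) K) :=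
  {F | ∃ q : ℕ, 0 < q ∧ (L.map ini).prod ^ q * F ∈ Ideal.span {T | T ∈ L}}

/-- A regular set: a triangular set such that `res(ini(T_j), [T_1, …, T_{j-1}]) ≠ 0`
for `j = 2, …, r`. -/
def RegularSet (L : List (MvPolynomial (Fin n) K)) : Prop :=
  TriangularSet L ∧
    ∀ j : ℕ, 0 < j → j < L.length → resTS (ini (L.getD j 0)) (L.take j) ≠ 0

/-- A normal triangular set: `deg(ini(T_j), lv(T_i)) = 0` for all `i < j`. -/
def NormalSet (L : List (MvPolynomial (Fin n) K)) : Prop :=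
  TriangularSet L ∧ L.Pairwise fun A B => degLv (ini B) A = 0

/-- The purely lexicographical order on monomials determined by `x_1 < ⋯ < x_n`. -/
def plexLT (a b : Fin n →₀ ℕ) : Prop :=
  ∃ k : Fin n, a k < b k ∧ ∀ j : Fin n, k < j → a j = b j

/-- `m` is the leading monomial of `P` w.r.t. the plex order. -/
def IsLpp (P : MvPolynomial (Fin n) K) (m : Fin n →₀ ℕ) : Prop :=
  m ∈ P.support ∧ ∀ m' ∈ P.support, m' ≠ m → plexLT m' m

/-- `G` is the reduced (Buchberger–)Gröbner basis of the ideal `I` w.r.t. the plex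
term order determined by `x_1 < ⋯ < x_n`: its elements are nonzero monic members of `I`,
the leading monomial of every nonzero member of `I` is divisible by the leading monomial
of some element of `G`, every element of `G` is B-reduced w.r.t. the others, and `G`
generates `I`. -/
def IsReducedGB (I : Ideal (MvPolynomial (Fin n) K)) (G : Finset (MvPolynomial (Fin n) K)) :
    Prop :=
  (∀ g ∈ G, g ∈ I ∧ g ≠ 0 ∧ ∀ m, IsLpp g m → g.coeff m = 1) ∧
    (∀ F ∈ I, F ≠ 0 → ∃ g ∈ G, ∃ mg mF, IsLpp g mg ∧ IsLpp F mF ∧ mg ≤ mF) ∧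
    (∀ g ∈ G, ∀ g' ∈ G, g' ≠ g → ∀ m ∈ g.support, ∀ m', IsLpp g' m' → ¬ m' ≤ m) ∧
    Ideal.span (G : Set (MvPolynomial (Fin n) K)) = I

/-- `Cs` is the W-characteristic set of `I`: the minimal triangular set contained in the
reduced plex Gröbner basis `G` of `I`, i.e. for each class realized in `G`, `Cs` contains
the element of that class whose leading monomial is minimal w.r.t. the plex order, the
elements being ordered by increasing class (equivalently, by the plex order). -/
def IsWCharSet (I : Ideal (MvPolynomial (Fin n) K)) (Cs : List (MvPolynomial (Fin n) K)) :
    Prop :=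
  ∃ G : Finset (MvPolynomial (Fin n) K), IsReducedGB I G ∧
    (Cs.Chain' fun A B => cls A < cls B) ∧
    (∀ c ∈ Cs, c ∈ G) ∧
    (∀ g ∈ G, ∃ c ∈ Cs, cls c = cls g) ∧
    ∀ c ∈ Cs, ∀ g ∈ G, cls g = cls c → g ≠ c →
      ∃ mc mg, IsLpp c mc ∧ IsLpp g mg ∧ plexLT mc mg

/-- The set of common zeros of a set `S` of polynomials over `k`, taken in `Kc ^ n`
for an extension `Kc` of `k`. -/
def zeroSet {k : Type*} [Field k] (Kc : Type*) [CommRing Kc] [Algebra k Kc]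
    (S : Set (MvPolynomial (Fin n) k)) : Set (Fin n → Kc) :=
  {a | ∀ p ∈ S, MvPolynomial.aeval a p = 0}


theorem sum_coefv_mul_X_pow (i : Fin n) (F : MvPolynomial (Fin n) K) :
    ∑ d ∈ Finset.range (F.degreeOf i + 1), coefv i d F * X i ^ d = F := by
  have hmaps : ∀ m ∈ F.support, m i ∈ Finset.range (F.degreeOf i + 1) := fun m hm =>
    Finset.mem_range.2 (Nat.lt_succ_of_le (monomial_le_degreeOf i hm))
  conv_rhs => rw [F.as_sum, ← Finset.sum_fiberwise_of_maps_to hmaps]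
  refine Finset.sum_congr rfl fun d _ => ?_
  rw [coefv, Finset.sum_mul]
  refine Finset.sum_congr rfl fun m hm => ?_
  obtain rfl := (Finset.mem_filter.1 hm).2
  rw [X_pow_eq_monomial, monomial_mul, mul_one, Finsupp.erase_add_single]

theorem coefv_mem_supported {i : Fin n} {d : ℕ} {F : MvPolynomial (Fin n) K} {s : Set (Fin n)}
    (hF : F ∈ supported K s) : coefv i d F ∈ supported K (s \ {i}) := by
  refine Subalgebra.sum_mem _ fun m hm => ?_
  have hm' := (Finset.mem_filter.1 hm).1
  rw [mem_supported, vars_monomial (mem_support_iff.1 hm')]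
  intro j hj
  have hj' := Finsupp.mem_support_iff.1 (Finset.mem_coe.1 hj)
  have hji : j ≠ i := by
    rintro rfl
    exact hj' Finsupp.erase_same
  rw [Finsupp.erase_ne hji] at hj'
  exact ⟨mem_supported.1 hF (mem_vars_iff_mem_support j |>.2 ⟨m, hm', Finsupp.mem_support_iff.2 hj'⟩), hji⟩

theorem apply_eq_zero_of_mem_supported {F : MvPolynomial (Fin n) K} {s : Set (Fin n)}
    (hF : F ∈ supported K s) {m : Fin n →₀ ℕ} (hm : m ∈ F.support) {j : Fin n} (hj : j ∉ s) :
    m j = 0 := by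
  by_contra h
  exact hj (mem_supported.1 hF (mem_vars_iff_mem_support j |>.2 ⟨m, hm, Finsupp.mem_support_iff.2 h⟩))

theorem degreeOf_eq_zero_of_mem_supported {F : MvPolynomial (Fin n) K} {s : Set (Fin n)}
    (hF : F ∈ supported K s) {j : Fin n} (hj : j ∉ s) : F.degreeOf j = 0 :=
  Nat.le_zero.1 (degreeOf_le_iff.2 fun _ hm => (apply_eq_zero_of_mem_supported hF hm hj).le)

theorem degreeOf_coefv (i : Fin n) (d : ℕ) (F : MvPolynomial (Fin n) K) :
    (coefv i d F).degreeOf i = 0 :=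
  degreeOf_eq_zero_of_mem_supported (s := Set.univ \ {i})
    (coefv_mem_supported (by simp)) (by simp)

theorem degreeOf_sub_lcv_mul_X_pow_lt {i : Fin n} {F : MvPolynomial (Fin n) K}
    (hF : 0 < F.degreeOf i) :
    (F - lcv i F * X i ^ F.degreeOf i).degreeOf i < F.degreeOf i := by
  have h : F - lcv i F * X i ^ F.degreeOf i =
      ∑ d ∈ Finset.range (F.degreeOf i), coefv i d F * X i ^ d := by
    conv_lhs => enter [1]; rw [← sum_coefv_mul_X_pow i F, Finset.sum_range_succ]
    simp [lcv]
  rw [h]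
  refine (degreeOf_sum_le _ _ _).trans_lt ((Finset.sup_lt_iff hF).2 fun d hd => ?_)
  refine (degreeOf_mul_le _ _ _).trans_lt ?_
  rw [degreeOf_coefv, degreeOf_X_self_pow, zero_add]
  exact Finset.mem_range.1 hd

theorem coeff_mul_X_pow_add {i : Fin n} {d : ℕ} {R T : MvPolynomial (Fin n) K}
    (hT : T.degreeOf i < d) (t : Fin n →₀ ℕ) :
    (R * X i ^ d + T).coeff (t + Finsupp.single i d) = R.coeff t := by
  have h : T.coeff (t + Finsupp.single i d) = 0 := by
    by_contra h
    have := monomial_le_degreeOf i (mem_support_iff.2 h)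
    simp at this
    omega
  rw [coeff_add, h, X_pow_eq_monomial, coeff_mul_monomial, mul_one, add_zero]

theorem sum_ite_coefv_mul_X_pow {i : Fin n} {F : MvPolynomial (Fin n) K} {N a : ℕ}
    (h : a + F.degreeOf i < N) :
    ∑ c : Fin N, (if a ≤ (c : ℕ) ∧ (c : ℕ) ≤ a + F.degreeOf i then
        coefv i (F.degreeOf i + a - (c : ℕ)) F else 0) * X i ^ (N - 1 - (c : ℕ)) =
      X i ^ (N - 1 - (a + F.degreeOf i)) * F := by
  rw [Fin.sum_univ_eq_sum_range (fun c => (if a ≤ c ∧ c ≤ a + F.degreeOf i then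
        coefv i (F.degreeOf i + a - c) F else 0) * X i ^ (N - 1 - c)) N]
  have hrhs : X i ^ (N - 1 - (a + F.degreeOf i)) * F = ∑ d ∈ Finset.range (F.degreeOf i + 1),
      X i ^ (N - 1 - (a + F.degreeOf i)) * (coefv i d F * X i ^ d) := by
    rw [← Finset.mul_sum, sum_coefv_mul_X_pow]
  rw [hrhs]
  simp only [ite_mul, zero_mul]
  rw [← Finset.sum_filter]
  refine Finset.sum_nbij' (fun c => F.degreeOf i + a - c) (fun d => F.degreeOf i + a - d)
    ?_ ?_ ?_ ?_ ?_
  all_goals simp only [Finset.mem_filter, Finset.mem_range]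
  · intro c hc; omega
  · intro d hd; omega
  · intro c hc; omega
  · intro d hd; omega
  · intro c hc
    rw [mul_left_comm, ← pow_add]
    congr 2
    omega

theorem resv_mem_of_mem {J : Ideal (MvPolynomial (Fin n) K)} {F G : MvPolynomial (Fin n) K}
    {i : Fin n} (hF : F ∈ J) (hG : G ∈ J) (hpos : 0 < G.degreeOf i) : resv F G i ∈ J := by
  set N := G.degreeOf i + F.degreeOf i with hN
  let v : Fin N → MvPolynomial (Fin n) K := fun c => X i ^ (N - 1 - (c : ℕ))
  have hw : ∀ r, (sylvester i F G).mulVec v r ∈ J := by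
    intro r
    have hr := r.2
    by_cases h : (r : ℕ) < G.degreeOf i
    · have := sum_ite_coefv_mul_X_pow (i := i) (F := F) (N := N) (a := r) (by omega)
      simp only [Matrix.mulVec, dotProduct, sylvester, Matrix.of_apply, if_pos h, v]
      rw [this]
      exact J.mul_mem_left _ hF
    · have := sum_ite_coefv_mul_X_pow (i := i) (F := G) (N := N) (a := r - G.degreeOf i)
        (by omega)
      rw [Nat.sub_add_cancel (not_lt.1 h)] at this
      simp only [Matrix.mulVec, dotProduct, sylvester, Matrix.of_apply, if_neg h, v]
      rw [this]
      exact J.mul_mem_left _ hG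
  have hdet : (sylvester i F G).adjugate.mulVec ((sylvester i F G).mulVec v) =
      (sylvester i F G).det • v := by
    rw [Matrix.mulVec_mulVec, Matrix.adjugate_mul, Matrix.smul_mulVec, Matrix.one_mulVec]
  have hlast := congrFun hdet ⟨N - 1, by omega⟩
  simp only [Pi.smul_apply, v, Nat.sub_self, pow_zero, smul_eq_mul, mul_one] at hlast
  rw [resv, ← hlast, Matrix.mulVec, dotProduct]
  exact J.sum_mem fun r _ => J.mul_mem_left _ (hw r)

theorem resv_mem_supported {F G : MvPolynomial (Fin n) K} {i : Fin n} {s : Set (Fin n)}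
    (hF : F ∈ supported K s) (hG : G ∈ supported K s) : resv F G i ∈ supported K (s \ {i}) := by
  rw [resv, Matrix.det_apply]
  refine Subalgebra.sum_mem _ fun σ _ => ?_
  rw [Units.smul_def]
  refine zsmul_mem (Subalgebra.prod_mem _ fun c _ => ?_) _
  simp only [sylvester, Matrix.of_apply]
  split_ifs
  · exact coefv_mem_supported hF
  · exact zero_mem _
  · exact coefv_mem_supported hG
  · exact zero_mem _

theorem cls_eq_max'_add_one {F : MvPolynomial (Fin n) K} (h : F.vars.Nonempty) :
    cls F = (F.vars.max' h : ℕ) + 1 := by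
  refine le_antisymm (Finset.sup_le fun i hi => ?_)
    (Finset.le_sup (f := fun i : Fin n => (i : ℕ) + 1) (F.vars.max'_mem h))
  exact Nat.succ_le_succ (Fin.le_def.1 (F.vars.le_max' i hi))

theorem vars_nonempty_of_cls_pos {F : MvPolynomial (Fin n) K} (h : 0 < cls F) :
    F.vars.Nonempty := by
  by_contra hF
  rw [Finset.not_nonempty_iff_eq_empty] at hF
  simp [cls, hF] at h

theorem mem_supported_cls (F : MvPolynomial (Fin n) K) :
    F ∈ supported K {j : Fin n | (j : ℕ) < cls F} := by
  rw [mem_supported]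
  exact fun j hj => Finset.le_sup (f := fun i : Fin n => (i : ℕ) + 1) (Finset.mem_coe.1 hj)

theorem exists_leading_var {F : MvPolynomial (Fin n) K} (h : 0 < cls F) :
    ∃ y : Fin n, cls F = (y : ℕ) + 1 ∧ 0 < F.degreeOf y ∧ ini F = lcv y F ∧
      (∀ G, degLv G F = G.degreeOf y) ∧ ∀ G, resLv G F = resv G F y := by
  have hne := vars_nonempty_of_cls_pos h
  refine ⟨F.vars.max' hne, cls_eq_max'_add_one hne, ?_, by rw [ini, dif_pos hne],
    fun G => by rw [degLv, dif_pos hne], fun G => by rw [resLv, dif_pos hne]⟩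
  obtain ⟨m, hm, hj⟩ := (mem_vars_iff_mem_support _).1 (F.vars.max'_mem hne)
  exact (Nat.pos_of_ne_zero (Finsupp.mem_support_iff.1 hj)).trans_le (monomial_le_degreeOf _ hm)

theorem resTS_mem_of_mem {J : Ideal (MvPolynomial (Fin n) K)} {F : MvPolynomial (Fin n) K}
    {L : List (MvPolynomial (Fin n) K)} (hF : F ∈ J) (hL : ∀ T ∈ L, T ∈ J)
    (hpos : ∀ T ∈ L, 0 < cls T) : resTS F L ∈ J := by
  induction L with
  | nil => exact hF
  | cons T L ih =>
    have ih' := ih (fun T' h => hL T' (List.mem_cons_of_mem _ h))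
      (fun T' h => hpos T' (List.mem_cons_of_mem _ h))
    obtain ⟨y, -, hy, -, -, hres⟩ := exists_leading_var (hpos T List.mem_cons_self)
    change resLv (resTS F L) T ∈ J
    rw [hres]
    exact resv_mem_of_mem ih' (hL T List.mem_cons_self) hy

theorem resTS_mem_supported {L : List (MvPolynomial (Fin n) K)} {a : ℕ}
    (hcls : ∀ i, i < L.length → cls (L.getD i 0) = a + i + 1) {j : ℕ} (hj : j ≤ L.length)
    {F : MvPolynomial (Fin n) K} (hF : F ∈ supported K {v : Fin n | (v : ℕ) < a + j}) :
    resTS F (L.take j) ∈ supported K {v : Fin n | (v : ℕ) < a} := by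
  induction j generalizing F with
  | zero => simpa [resTS] using hF
  | succ j ih =>
    have hc := hcls j hj
    obtain ⟨y, hy, -, -, -, hres⟩ := exists_leading_var (F := L.getD j 0) (by omega)
    have htake : L.take (j + 1) = L.take j ++ [L.getD j 0] := by
      rw [List.take_add_one, List.getD_eq_getElem _ _ hj, List.getElem?_eq_getElem hj]
      rfl
    have hstep : resTS F (L.take (j + 1)) = resTS (resLv F (L.getD j 0)) (L.take j) := by
      rw [htake, resTS, List.foldr_append]
      rfl
    rw [hstep, hres]
    refine ih (Nat.le_of_succ_le hj) (supported_mono ?_ (resv_mem_supported (i := y) hF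
      (supported_mono ?_ (mem_supported_cls (L.getD j 0)))))
    · rintro v ⟨hv, hvy⟩
      have : (v : ℕ) ≠ y := fun h => hvy (Fin.ext h)
      simp only [Set.mem_ofPred_eq] at hv ⊢
      omega
    · intro v hv
      simp only [Set.mem_ofPred_eq] at hv ⊢
      omega

theorem plexLT_trans {a b c : Fin n →₀ ℕ} (hab : plexLT a b) (hbc : plexLT b c) :
    plexLT a c := by
  obtain ⟨k, hk, hk'⟩ := hab
  obtain ⟨l, hl, hl'⟩ := hbc
  rcases lt_trichotomy k l with h | rfl | h
  · exact ⟨l, by rw [hk' l h]; exact hl, fun j hj => by rw [hk' j (h.trans hj), hl' j hj]⟩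
  · exact ⟨k, hk.trans hl, fun j hj => by rw [hk' j hj, hl' j hj]⟩
  · exact ⟨k, by rw [← hl' k h]; exact hk, fun j hj => by rw [hk' j hj, hl' j (h.trans hj)]⟩

theorem not_plexLT_self (a : Fin n →₀ ℕ) : ¬ plexLT a a := fun ⟨_, hk, _⟩ => lt_irrefl _ hk

theorem IsLpp.unique {F : MvPolynomial (Fin n) K} {a b : Fin n →₀ ℕ} (ha : IsLpp F a)
    (hb : IsLpp F b) : a = b := by
  by_contra h
  exact not_plexLT_self a (plexLT_trans (hb.2 a ha.1 h) (ha.2 b hb.1 (Ne.symm h)))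

theorem IsLpp.eq_or_plexLT {F : MvPolynomial (Fin n) K} {a b : Fin n →₀ ℕ} (ha : IsLpp F a)
    (hb : b ∈ F.support) : b = a ∨ plexLT b a :=
  or_iff_not_imp_left.2 (ha.2 b hb)

theorem IsLpp.cls_le {F : MvPolynomial (Fin n) K} {m : Fin n →₀ ℕ} (hm : IsLpp F m) {a : ℕ}
    (h : ∀ j : Fin n, a ≤ (j : ℕ) → m j = 0) : cls F ≤ a := by
  refine Finset.sup_le fun i hi => ?_
  obtain ⟨m', hm', hj⟩ := (mem_vars_iff_mem_support _).1 hi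
  rw [Finsupp.mem_support_iff] at hj
  by_contra hia
  rcases hm.eq_or_plexLT hm' with rfl | ⟨k, hk, hk'⟩
  · exact hj (h i (by omega))
  · rcases lt_or_ge k i with hki | hki
    · exact hj ((hk' i hki).trans (h i (by omega)))
    · have := h k (by have := Fin.le_def.1 hki; omega)
      omega

theorem exists_eq_mul_add_of_mem_supported {s : Set (Fin n)} {F R : MvPolynomial (Fin n) K}
    {S : Set (MvPolynomial (Fin n) K)} (hF : F ∈ supported K s) (hR : R ∈ supported K s)
    (hS : ∀ T ∈ S, T ∈ supported K s) (h : R ∈ Ideal.span {F} ⊔ Ideal.span S) :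
    ∃ A ∈ supported K s, ∃ B ∈ supported K s, B ∈ Ideal.span S ∧ R = A * F + B := by
  classical
  let φ : MvPolynomial (Fin n) K →ₐ[K] MvPolynomial (Fin n) K :=
    aeval fun j => if j ∈ s then X j else 0
  have hφ : ∀ p ∈ supported K s, φ p = p := by
    intro p hp
    refine (AlgHom.eqOn_adjoin_iff (φ := φ) (ψ := AlgHom.id K _)).2 ?_ hp
    rintro _ ⟨j, hj, rfl⟩
    simp [φ, hj]
  have hmem : ∀ p, φ p ∈ supported K s := by
    intro p
    induction p using MvPolynomial.induction_on with
    | C a => simpa [φ] using (supported K s).algebraMap_mem a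
    | add p q hp hq => rw [map_add]; exact add_mem hp hq
    | mul_X p j hp =>
      rw [map_mul]
      refine mul_mem hp ?_
      by_cases hj : j ∈ s
      · simp [φ, hj, X_mem_supported]
      · simp [φ, hj]
  obtain ⟨A, B, hB, hAB⟩ := Ideal.mem_span_singleton_sup.1 h
  refine ⟨φ A, hmem A, φ B, hmem B, ?_, ?_⟩
  · have hmap := Ideal.mem_map_of_mem φ hB
    rw [Ideal.map_span] at hmap
    refine Ideal.span_mono ?_ hmap
    rintro _ ⟨T, hT, rfl⟩
    rwa [hφ T (hS T hT)]
  · rw [← hφ R hR, ← hAB, map_add, map_mul, hφ F hF]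

/-- A polynomial of an ideal of the form `A * F + B * y ^ d`, where `y` is the leading variable
of `F` and `d` the degree of `F` in it, has leading monomial `t * y ^ d`, with `t` a monomial
of `A * ini F + B`. -/
theorem exists_isLpp_of_mul_ini_add {F A B : MvPolynomial (Fin n) K} {y : Fin n}
    (hcls : cls F = (y : ℕ) + 1) (hd : 0 < F.degreeOf y)
    (hA : A ∈ supported K {v : Fin n | v < y}) (hB : B ∈ supported K {v : Fin n | v < y})
    (hR : A * lcv y F + B ≠ 0) :
    A * F + B * X y ^ F.degreeOf y ≠ 0 ∧
      ∀ m, IsLpp (A * F + B * X y ^ F.degreeOf y) m →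
        ∃ t ∈ (A * lcv y F + B).support, m = t + Finsupp.single y (F.degreeOf y) := by
  set d := F.degreeOf y
  set T := A * (F - lcv y F * X y ^ d) with hT
  set R := A * lcv y F + B with hR'
  have hp : A * F + B * X y ^ d = R * X y ^ d + T := by rw [hT, hR']; ring
  have hTd : T.degreeOf y < d := by
    refine (degreeOf_mul_le _ _ _).trans_lt ?_
    rw [degreeOf_eq_zero_of_mem_supported hA (by simp), zero_add]
    exact degreeOf_sub_lcv_mul_X_pow_lt hd
  obtain ⟨t, ht⟩ := ne_zero_iff.1 hR
  have hq : t + Finsupp.single y d ∈ (A * F + B * X y ^ d).support := by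
    rw [mem_support_iff, hp, coeff_mul_X_pow_add hTd]
    exact ht
  refine ⟨fun h => by simp [h] at hq, fun m hm => ?_⟩
  have hsupp : A * F + B * X y ^ d ∈ supported K {v : Fin n | v ≤ y} := by
    have hlt : ({v : Fin n | v < y}) ⊆ {v : Fin n | v ≤ y} :=
      Set.ofPred_subset_ofPred.2 fun v hv => le_of_lt hv
    refine add_mem (mul_mem (supported_mono hlt hA) (supported_mono ?_ (mem_supported_cls F)))
      (mul_mem (supported_mono hlt hB) (pow_mem ((X_mem_supported (s := {v : Fin n | v ≤ y})).2 (by simp)) _))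
    intro v hv
    simp only [Set.mem_ofPred_eq, Fin.le_def] at hv ⊢
    omega
  have hmy : d ≤ m y := by
    rcases hm.eq_or_plexLT hq with h | ⟨k, hk, hk'⟩
    · simp [← h]
    · have hky : k ≤ y := by
        by_contra hky
        have := apply_eq_zero_of_mem_supported hsupp hm.1 (j := k) hky
        omega
      rcases hky.lt_or_eq with hky | rfl
      · simp [← hk' y hky]
      · simp at hk
        omega
  have hle : Finsupp.single y d ≤ m := Finsupp.single_le_iff.2 hmy
  refine ⟨m - Finsupp.single y d, ?_, (tsub_add_cancel_of_le hle).symm⟩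
  have := hm.1
  rw [mem_support_iff, hp] at this
  rw [mem_support_iff, ← coeff_mul_X_pow_add hTd, tsub_add_cancel_of_le hle]
  exact this

/-- Lemma mainlem (a). Let `[C_1, …, C_r]` be the W-characteristic set
of `⟨P⟩` under the variable ordering in which the leading variables of the `C_i` are the
`r` greatest variables, and let `k` be the biggest integer such that `C_k = [C_1, …, C_k]`
is normal (so `C_{k+1} = [C_1, …, C_{k+1}]` is not normal). If `k < r`, then `C_{k+1}` is
not regular. -/
theorem statement14 {n : ℕ} {K : Type*} [Field K]
    (P : Finset (MvPolynomial (Fin n) K)) (hne : P.Nonempty) (h0 : ∀ p ∈ P, p ≠ 0)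
    (hproper : Ideal.span (P : Set (MvPolynomial (Fin n) K)) ≠ ⊤)
    (Cs : List (MvPolynomial (Fin n) K))
    (hW : IsWCharSet (Ideal.span (P : Set (MvPolynomial (Fin n) K))) Cs)
    (hord : ∀ i, i < Cs.length → cls (Cs.getD i 0) = n - Cs.length + i + 1)
    (k : ℕ) (hkr : k < Cs.length)
    (hnorm : NormalSet (Cs.take k))
    (hmax : ¬ NormalSet (Cs.take (k + 1))) :
    ¬ RegularSet (Cs.take (k + 1)) := by
  intro hreg
  obtain ⟨G, ⟨-, hGB, -, hspan⟩, -, hCG, hGC, hmin⟩ := hW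
  set I := Ideal.span (P : Set (MvPolynomial (Fin n) K))
  set a := n - Cs.length
  have hk0 : 0 < k := by
    rcases Nat.eq_zero_or_pos k with rfl | h
    · exact absurd (List.take_zero) hnorm.1.1
    · exact h
  have hget : ∀ i, i < Cs.length → Cs.getD i 0 ∈ Cs := fun i hi => by
    rw [List.getD_eq_getElem _ _ hi]; exact List.getElem_mem hi
  have hmemcls : ∀ c ∈ Cs, ∃ i, i < Cs.length ∧ c = Cs.getD i 0 := fun c hc => by
    obtain ⟨i, hi, rfl⟩ := List.getElem_of_mem hc
    exact ⟨i, hi, (List.getD_eq_getElem _ _ hi).symm⟩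
  have htakecls : ∀ T ∈ Cs.take k, ∃ i, i < k ∧ T = Cs.getD i 0 := fun T hT => by
    obtain ⟨i, hi, rfl⟩ := List.mem_take_iff_getElem.1 hT
    rw [lt_min_iff] at hi
    exact ⟨i, hi.1, (List.getD_eq_getElem _ _ hi.2).symm⟩
  have hI : ∀ c ∈ Cs, c ∈ I := fun c hc => hspan ▸ Ideal.subset_span (hCG c hc)
  have hclsF := hord k hkr
  have htake : Cs.take (k + 1) = Cs.take k ++ [Cs.getD k 0] := by
    rw [List.take_add_one, List.getD_eq_getElem _ _ hkr, List.getElem?_eq_getElem hkr]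
    rfl
  obtain ⟨T, hTk, hTdeg⟩ : ∃ T ∈ Cs.take k, degLv (ini (Cs.getD k 0)) T ≠ 0 := by
    by_contra! hcon
    refine hmax ⟨hreg.1, ?_⟩
    rw [htake, List.pairwise_append]
    refine ⟨hnorm.2, List.pairwise_singleton _ _, fun A hA B hB => ?_⟩
    rw [List.mem_singleton.1 hB]
    exact hcon A hA
  have hRne : resTS (ini (Cs.getD k 0)) (Cs.take k) ≠ 0 := by
    have h := hreg.2 k hk0 (by rw [List.length_take]; omega)
    rw [List.take_take, min_eq_left (Nat.le_succ k)] at h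
    have hgetk : (Cs.take (k + 1)).getD k 0 = Cs.getD k 0 := by
      rw [List.getD_eq_getElem?_getD, List.getElem?_take_of_lt (Nat.lt_succ_self k),
        List.getD_eq_getElem?_getD]
    rwa [hgetk] at h
  obtain ⟨i, hik, rfl⟩ := htakecls T hTk
  have hclsT := hord i (hik.trans hkr)
  obtain ⟨z, hz, -, -, hzdeg, -⟩ := exists_leading_var (F := Cs.getD i 0) (by omega)
  rw [hzdeg] at hTdeg
  have hFmem := hget k hkr
  set F := Cs.getD k 0 with hFdef
  obtain ⟨y, hy, hd, hini, -, -⟩ := exists_leading_var (F := F) (by omega)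
  rw [hini] at hTdeg hRne
  have hF : F ∈ supported K {v : Fin n | v ≤ y} :=
    supported_mono (fun v hv => by
      simp only [Set.mem_ofPred_eq, Fin.le_def] at hv ⊢; omega) (mem_supported_cls F)
  have hlc : lcv y F ∈ supported K {v : Fin n | v < y} :=
    supported_mono (fun v hv => by
      simp only [Set.mem_sdiff, Set.mem_ofPred_eq, Set.mem_singleton_iff] at hv ⊢
      exact lt_of_le_of_ne hv.1 hv.2) (coefv_mem_supported hF)
  have hset : {v : Fin n | v < y} = {v : Fin n | (v : ℕ) < a + k} := by
    ext v; simp only [Set.mem_ofPred_eq, Fin.lt_def]; omega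
  have hRu : resTS (lcv y F) (Cs.take k) ∈ supported K {v : Fin n | (v : ℕ) < a} :=
    resTS_mem_supported hord hkr.le (hset ▸ hlc)
  obtain ⟨A, hA, B, hB, hBI, hR⟩ := exists_eq_mul_add_of_mem_supported
    (S := {T | T ∈ Cs.take k}) hlc
    (supported_mono (fun v hv => by
      simp only [Set.mem_ofPred_eq, Fin.lt_def] at hv ⊢; omega) hRu)
    (fun T hT => by
      obtain ⟨j, hj, rfl⟩ := htakecls T hT
      have := hord j (hj.trans hkr)
      exact supported_mono (fun v hv => by
        simp only [Set.mem_ofPred_eq, Fin.lt_def] at hv ⊢; omega) (mem_supported_cls _))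
    (resTS_mem_of_mem (Ideal.mem_sup_left (Ideal.mem_span_singleton_self _))
      (fun T hT => Ideal.mem_sup_right (Ideal.subset_span hT)) hnorm.1.2.1)
  rw [hR] at hRne hRu
  obtain ⟨hpne, hplpp⟩ := exists_isLpp_of_mul_ini_add hy hd hA hB hRne
  have hpI : A * F + B * X y ^ F.degreeOf y ∈ I :=
    add_mem (I.mul_mem_left _ (hI F hFmem)) (I.mul_mem_right _
      (Ideal.span_le.2 (fun T hT => hI T (List.mem_of_mem_take hT)) hBI))
  obtain ⟨g, hg, mg, mp, hmg, hmp, hle⟩ := hGB _ hpI hpne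
  obtain ⟨t, ht, rfl⟩ := hplpp mp hmp
  have htu : ∀ j : Fin n, a ≤ (j : ℕ) → t j = 0 := fun j hj =>
    apply_eq_zero_of_mem_supported hRu ht (by simpa using hj)
  have hmgz : ∀ j : Fin n, a ≤ (j : ℕ) → j ≠ y → mg j = 0 := fun j hj hjy => by
    have := hle j
    simpa [htu j hj, Finsupp.single_eq_of_ne hjy] using this
  have hmgy : mg y ≤ F.degreeOf y := by
    have := hle y
    simpa [htu y (by omega)] using this
  have hclsg : cls g = cls F := by
    obtain ⟨c, hc, hcg⟩ := hGC g hg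
    obtain ⟨j, hj, rfl⟩ := hmemcls c hc
    have hcj := hord j hj
    have hle1 : cls g ≤ (y : ℕ) + 1 := hmg.cls_le fun j hj =>
      hmgz j (by omega) (by rintro rfl; omega)
    by_contra hne'
    have hmgy0 : mg y = 0 := by
      by_contra h0
      have := apply_eq_zero_of_mem_supported (mem_supported_cls g) hmg.1 (j := y)
        (by simp only [Set.mem_ofPred_eq]; omega)
      exact h0 this
    have := hmg.cls_le (a := a) fun j hj => by
      by_cases hjy : j = y
      · rw [hjy, hmgy0]
      · exact hmgz j hj hjy
    omega
  obtain ⟨s, hs, hsz⟩ : ∃ s ∈ (lcv y F).support, s z ≠ 0 := by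
    by_contra! hcon
    exact hTdeg (Nat.le_zero.1 (degreeOf_le_iff.2 fun m hm => (hcon m hm).le))
  have hq : s + Finsupp.single y (F.degreeOf y) ∈ F.support := by
    have h := coeff_mul_X_pow_add (R := lcv y F) (degreeOf_sub_lcv_mul_X_pow_lt hd) s
    rw [add_sub_cancel] at h
    rw [mem_support_iff, h]
    exact mem_support_iff.1 hs
  have hqmg : s + Finsupp.single y (F.degreeOf y) = mg ∨
      plexLT (s + Finsupp.single y (F.degreeOf y)) mg := by
    by_cases hgF : g = F
    · subst hgF; exact hmg.eq_or_plexLT hq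
    · obtain ⟨mc, mg', hmc, hmg', hlt⟩ := hmin F hFmem g hg hclsg hgF
      obtain rfl := hmg.unique hmg'
      rcases hmc.eq_or_plexLT hq with h | h
      · exact Or.inr (h ▸ hlt)
      · exact Or.inr (plexLT_trans h hlt)
  have hzy : z ≠ y := by rintro rfl; omega
  have hmz : mg z = 0 := hmgz z (by omega) hzy
  rcases hqmg with h | ⟨l, hl, hl'⟩
  · rw [← h] at hmz
    simp only [Finsupp.add_apply] at hmz
    omega
  · by_cases hly : l = y
    · subst hly
      simp at hl
      omega
    · have hla : (l : ℕ) < a := by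
        by_contra h
        rw [hmgz l (by omega) hly] at hl
        omega
      have := hl' z (Fin.lt_def.2 (by omega))
      rw [hmz] at this
      simp only [Finsupp.add_apply] at this
      omega

end CharSets
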